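/- Let (Δ, 𝓕, P) be a probability space, let d ≥ 1, let c ∈ ℝ^d, let X ⊆ ℝ^d be a convex set, and for each δ ∈ Δ let X_δ ⊆ ℝ^d be a convex set such that for every x ∈ ℝ^d the set {δ ∈ Δ : x ∉ X_δ} is measurable. Assume that for every N and every sample tuple (δ₁, …, δ_N) ∈ Δ^N the scenario program — minimize c᷀ᵀx over x ∈ X subject to x ∈ X_{δ_i} for all i = 1, …, N — is solvable and has a unique minimizer x*_N(δ₁, …, δ_N), and that the map (δ₁, …, δ_N) ↦ x*_N(δ₁, …, δ_N) and the map (δ₁, …, δ_N) ↦ V(x*_N(δ₁, …, δ_N)) are measurable, where the violation probability is V(x) = P[{δ ∈ Δ : x ∉ X_δ}]. Then for every ε ∈ [0,1], the product measure P^N of the set of sample tuples (δ₁, …, δ_N) with V(x*_N(δ₁, …, δ_N)) > ε is at most Σ_{i=0}^{d−1} C(N, i) ε^i (1 − ε)^{N−i}. -/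

import Mathlib

open MeasureTheory
open scoped RealInnerProductSpace

/-- The number of `N`-subsets of `{0, …, M - 1}` with fewer than `d` elements below `k + d - 1`. -/
def hyperTail (M N d k : ℕ) : ℕ :=
  ∑ i ∈ Finset.range d, (k + d - 1).choose i * (M - (k + d - 1)).choose (N - i)

theorem hyperTail_succ (M N d k : ℕ) (hdN : d + 1 ≤ N) (hk : k + (d + 1) ≤ M) :
    hyperTail M N (d + 1) k = hyperTail M N (d + 1) (k + 1) +
      (k + d).choose d * (M - (d + 1) - k).choose (N - (d + 1)) := by
  obtain ⟨L, rfl⟩ : ∃ L, M = k + d + 1 + L := ⟨M - (k + d + 1), by omega⟩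
  have e1 : k + d + 1 + L - (k + (d + 1) - 1) = L + 1 := by omega
  have e2 : k + d + 1 + L - (k + 1 + (d + 1) - 1) = L := by omega
  have e3 : k + d + 1 + L - (d + 1) - k = L := by omega
  have e4 : k + (d + 1) - 1 = k + d := by omega
  have e5 : k + 1 + (d + 1) - 1 = k + d + 1 := by omega
  rw [hyperTail, hyperTail, e1, e2, e3, e4, e5]
  generalize k + d = K
  have : ∀ i ∈ Finset.range (d + 1), K.choose i * (L + 1).choose (N - i) =
      K.choose i * L.choose (N - (i + 1)) + K.choose i * L.choose (N - i) := by
    intro i hi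
    have := Finset.mem_range.1 hi
    obtain ⟨n, hn⟩ : ∃ n, N - i = n + 1 := ⟨N - i - 1, by omega⟩
    rw [hn, show N - (i + 1) = n by omega, Nat.choose_succ_succ, mul_add]
  rw [Finset.sum_congr rfl this, Finset.sum_add_distrib, Finset.sum_range_succ,
    Finset.sum_range_succ' (fun i => K.choose i * L.choose (N - i)),
    Finset.sum_range_succ' (fun i => (K + 1).choose i * L.choose (N - i))]
  simp only [Nat.choose_succ_succ, add_mul, Finset.sum_add_distrib, Nat.choose_zero_right]
  ring

theorem hyperTail_zero (M N d : ℕ) (hdN : d + 1 ≤ N) (hM : N ≤ M) :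
    hyperTail M N (d + 1) 0 = M.choose N := by
  simp only [hyperTail]
  have h := Nat.add_choose_eq d (M - d) N
  rw [Nat.add_sub_cancel' (by omega), Finset.Nat.sum_antidiagonal_eq_sum_range_succ_mk] at h
  rw [h]
  simp only [zero_add, Nat.add_sub_cancel]
  refine Finset.sum_subset (fun i hi => ?_) fun i _ hi => ?_
  · simp at hi ⊢; omega
  · rw [Nat.choose_eq_zero_of_lt, zero_mul]
    simpa using hi

theorem hyperTail_last (M N d : ℕ) (hdN : d + 1 ≤ N) :
    hyperTail M N (d + 1) (M - (d + 1) + 1) = 0 := by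
  refine Finset.sum_eq_zero fun i hi => ?_
  have := Finset.mem_range.1 hi
  rw [Nat.choose_eq_zero_of_lt (n := M - _), mul_zero]
  omega

theorem sum_choose_mul_choose_eq_hyperTail (M N d k : ℕ) (hdN : d + 1 ≤ N) (hM : N ≤ M)
    (hk : k ≤ M - (d + 1) + 1) :
    ∑ v ∈ Finset.range (M - (d + 1) + 1) with k ≤ v,
      (v + d).choose d * (M - (d + 1) - v).choose (N - (d + 1)) = hyperTail M N (d + 1) k := by
  induction hk using Nat.decreasingInduction with
  | self =>
    rw [hyperTail_last M N d hdN, Finset.filter_false_of_mem, Finset.sum_empty]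
    intro v hv
    have := Finset.mem_range.1 hv
    omega
  | of_succ k hk ih =>
    rw [hyperTail_succ M N d k hdN (by omega), ← ih]
    have : (Finset.range (M - (d + 1) + 1)).filter (k ≤ ·) =
        insert k ((Finset.range (M - (d + 1) + 1)).filter (k + 1 ≤ ·)) := by
      ext v
      simp only [Finset.mem_filter, Finset.mem_insert, Finset.mem_range]
      omega
    rw [this, Finset.sum_insert (by simp), add_comm]

theorem eq_choose_of_sum_mul_choose {M d : ℕ} (hd : d + 1 ≤ M) (b : ℕ → ℕ)
    (hb : ∀ n, d + 1 ≤ n → n ≤ M →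
      ∑ v ∈ Finset.range (M - (d + 1) + 1), b v * (M - (d + 1) - v).choose (n - (d + 1)) =
        M.choose n) (v : ℕ) (hv : v ≤ M - (d + 1)) : b v = (v + d).choose d := by
  induction v using Nat.strong_induction_on with
  | _ v ih =>
    have key : ∀ f : ℕ → ℕ, ∑ u ∈ Finset.range (M - (d + 1) + 1),
        f u * (M - (d + 1) - u).choose (M - v - (d + 1)) =
        ∑ u ∈ Finset.range v, f u * (M - (d + 1) - u).choose (M - v - (d + 1)) + f v := by
      intro f
      rw [← Finset.sum_subset (Finset.range_subset_range.2 (show v + 1 ≤ M - (d + 1) + 1 by omega)),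
        Finset.sum_range_succ, show M - (d + 1) - v = M - v - (d + 1) by omega, Nat.choose_self,
        mul_one]
      intro u hu' hu
      rw [Finset.mem_range] at hu' hu
      rw [Nat.choose_eq_zero_of_lt (by omega), mul_zero]
    have h1 := hb (M - v) (by omega) (by omega)
    have h2 := sum_choose_mul_choose_eq_hyperTail M (M - v) d 0 (by omega) (by omega) (by omega)
    rw [hyperTail_zero M _ d (by omega) (by omega), Finset.filter_true_of_mem (by simp)] at h2
    rw [key] at h1
    rw [key (fun u => (u + d).choose d), ← h1,
      Finset.sum_congr rfl fun u hu => by rw [← ih u (by simpa using hu) (by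
        have := Finset.mem_range.1 hu; omega)]] at h2
    omega

/-- An abstract system of bases (`core`) and violated elements (`viol`) on the finite subsets of `ι`:
the core and the violated elements do not change on passing to a set that contains the core and
no violated element. -/
structure ViolatorSystem (ι : Type*) where
  core : Finset ι → Finset ι
  viol : Finset ι → Finset ι
  core_subset : ∀ S, core S ⊆ S
  disjoint_viol : ∀ S, Disjoint S (viol S)
  core_congr : ∀ S T, core S ⊆ T → Disjoint T (viol S) → core T = core S
  viol_congr : ∀ S T, core S ⊆ T → Disjoint T (viol S) → viol T = viol S

namespace ViolatorSystem

variable {ι : Type*}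

theorem core_eq_iff (W : ViolatorSystem ι) {B I : Finset ι} (hB : W.core B = B) :
    W.core I = B ↔ B ⊆ I ∧ Disjoint I (W.viol B) := by
  constructor
  · rintro h
    refine ⟨h ▸ W.core_subset I, ?_⟩
    have hBI : B ⊆ I := h ▸ W.core_subset I
    rw [W.viol_congr I B h.subset (Disjoint.mono_left hBI (W.disjoint_viol I))]
    exact W.disjoint_viol I
  · rintro ⟨h1, h2⟩
    rw [W.core_congr B I (hB.subset.trans h1) h2, hB]

variable [Fintype ι] [DecidableEq ι]

/-- Enlarge every core with fewer than `d` elements by the remaining element of largest label. -/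
def pad (V : ViolatorSystem ι) (d : ℕ) (r : ι → ℕ) (hr : r.Injective) : ViolatorSystem ι where
  core S := if (V.core S).card < d then
    V.core S ∪ {j ∈ S \ V.core S | ∀ i ∈ S \ V.core S, r i ≤ r j} else V.core S
  viol S := if (V.core S).card < d then
    V.viol S ∪ ({j | j ∉ S ∧ ∀ i ∈ S \ V.core S, r i < r j} : Finset ι) else V.viol S
  core_subset S := by
    have := V.core_subset S
    split_ifs
    · intro x hx
      simp only [Finset.mem_union, Finset.mem_filter, Finset.mem_sdiff] at hx
      rcases hx with h | h
      · exact this h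
      · exact h.1.1
    · exact this
  disjoint_viol S := by
    have := V.disjoint_viol S
    split_ifs
    · rw [Finset.disjoint_union_right]
      refine ⟨this, Finset.disjoint_left.2 fun x hx hx' => ?_⟩
      simp only [Finset.mem_filter] at hx'
      exact hx'.2.1 hx
    · exact this
  core_congr S T h1 h2 := by
    split_ifs at h1 h2 with hlt
    · have hCT := Finset.union_subset_left h1
      have hD := (Finset.disjoint_union_right.1 h2).1
      have hC := V.core_congr S T hCT hD
      rw [if_pos hlt, hC, if_pos hlt]
      congr 1
      have hS := V.core_subset S
      ext j
      simp only [Finset.mem_filter, Finset.mem_sdiff]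
      rcases (S \ V.core S).eq_empty_or_nonempty with he | hne
      · have hTS : T ⊆ S := fun x hx => by
          by_contra hxS
          refine Finset.disjoint_left.1 h2 hx (Finset.mem_union_right _ ?_)
          simp [hxS, he]
        have : S = T := ((Finset.sdiff_eq_empty_iff_subset.1 he).trans hCT).antisymm hTS
        rw [this]
      · obtain ⟨m, hm, hmax⟩ := Finset.exists_max_image _ r hne
        have hmT : m ∈ T := h1 (Finset.mem_union_right _ (by simpa [hm] using hmax))
        have hTmax : ∀ i ∈ T, i ∉ V.core S → r i ≤ r m := by
          intro i hi hiC
          by_cases hiS : i ∈ S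
          · exact hmax i (by simp [hiS, hiC])
          · by_contra! hlt'
            refine Finset.disjoint_left.1 h2 hi (Finset.mem_union_right _ ?_)
            simp only [Finset.mem_filter, Finset.mem_univ, true_and]
            exact ⟨hiS, fun k hk => (hmax k hk).trans_lt hlt'⟩
        simp only [Finset.mem_sdiff] at hm hmax
        constructor
        · rintro ⟨⟨h3, h4⟩, h5⟩
          obtain rfl : j = m := hr (le_antisymm (hTmax j h3 h4) (h5 m ⟨hmT, hm.2⟩))
          exact ⟨hm, hmax⟩
        · rintro ⟨⟨h3, h4⟩, h5⟩
          obtain rfl : j = m := hr (le_antisymm (hmax j ⟨h3, h4⟩) (h5 m hm))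
          exact ⟨⟨hmT, h4⟩, fun i hi => hTmax i hi.1 hi.2⟩
    · have hC := V.core_congr S T h1 h2
      rw [if_neg hlt, hC, if_neg hlt]
  viol_congr S T h1 h2 := by
    split_ifs at h1 h2 with hlt
    · have hCT := Finset.union_subset_left h1
      have hD := (Finset.disjoint_union_right.1 h2).1
      have hC := V.core_congr S T hCT hD
      rw [if_pos hlt, hC, if_pos hlt, V.viol_congr S T hCT hD]
      congr 1
      have hS := V.core_subset S
      ext j
      simp only [Finset.mem_filter, Finset.mem_sdiff, Finset.mem_univ, true_and]
      rcases (S \ V.core S).eq_empty_or_nonempty with he | hne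
      · have hTS : T ⊆ S := fun x hx => by
          by_contra hxS
          refine Finset.disjoint_left.1 h2 hx (Finset.mem_union_right _ ?_)
          simp [hxS, he]
        have : S = T := ((Finset.sdiff_eq_empty_iff_subset.1 he).trans hCT).antisymm hTS
        rw [this]
      · obtain ⟨m, hm, hmax⟩ := Finset.exists_max_image _ r hne
        have hmT : m ∈ T := h1 (Finset.mem_union_right _ (by simpa [hm] using hmax))
        have hTmax : ∀ i ∈ T, i ∉ V.core S → r i ≤ r m := by
          intro i hi hiC
          by_cases hiS : i ∈ S
          · exact hmax i (by simp [hiS, hiC])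
          · by_contra! hlt'
            refine Finset.disjoint_left.1 h2 hi (Finset.mem_union_right _ ?_)
            simp only [Finset.mem_filter, Finset.mem_univ, true_and]
            exact ⟨hiS, fun k hk => (hmax k hk).trans_lt hlt'⟩
        simp only [Finset.mem_sdiff] at hm hmax
        constructor
        · rintro ⟨h3, h4⟩
          have := h4 m ⟨hmT, hm.2⟩
          refine ⟨fun hjS => ?_, fun i hi => (hmax i hi).trans_lt this⟩
          by_cases hjC : j ∈ V.core S
          · exact h3 (hCT hjC)
          · exact this.not_ge (hmax j ⟨hjS, hjC⟩)
        · rintro ⟨h3, h4⟩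
          have := h4 m hm
          exact ⟨fun hjT => this.not_ge (hTmax j hjT fun h => h3 (hS h)),
            fun i hi => (hTmax i hi.1 hi.2).trans_lt this⟩
    · have hC := V.core_congr S T h1 h2
      rw [if_neg hlt, hC, if_neg hlt, V.viol_congr S T h1 h2]

theorem exists_regular (V : ViolatorSystem ι) {d : ℕ} (hV : ∀ S, (V.core S).card ≤ d) :
    ∃ W : ViolatorSystem ι, (∀ S, V.viol S ⊆ W.viol S) ∧
      ∀ S, d ≤ S.card → (W.core S).card = d := by
  suffices h : ∀ n, ∃ W : ViolatorSystem ι, (∀ S, V.viol S ⊆ W.viol S) ∧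
      ∀ S, (W.core S).card ≤ d ∧ (n ≤ d → n ≤ S.card → n ≤ (W.core S).card) by
    obtain ⟨W, h1, h2⟩ := h d
    exact ⟨W, h1, fun S hS => le_antisymm (h2 S).1 ((h2 S).2 le_rfl hS)⟩
  intro n
  induction n with
  | zero => exact ⟨V, fun S => subset_rfl, fun S => ⟨hV S, by simp⟩⟩
  | succ n ih =>
    obtain ⟨W, h1, h2⟩ := ih
    let r : ι → ℕ := fun i => Fintype.equivFin ι i
    have hr : r.Injective := fun i j h => (Fintype.equivFin ι).injective (Fin.ext h)
    refine ⟨W.pad d r hr, fun S => (h1 S).trans ?_, fun S => ?_⟩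
    · simp only [pad]
      split_ifs
      · exact Finset.subset_union_left
      · exact subset_rfl
    · obtain ⟨h3, h4⟩ := h2 S
      simp only [pad]
      split_ifs with hlt
      · set F := S \ W.core S with hF
        have hdisj : Disjoint (W.core S) {j ∈ F | ∀ i ∈ F, r i ≤ r j} :=
          Finset.disjoint_left.2 fun x hx hx' => by
            simp [hF, hx] at hx'
        rw [Finset.card_union_of_disjoint hdisj]
        have hle : ({j ∈ F | ∀ i ∈ F, r i ≤ r j} : Finset ι).card ≤ 1 := by
          refine Finset.card_le_one.2 fun a ha b hb => ?_
          simp only [Finset.mem_filter] at ha hb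
          exact hr (le_antisymm (hb.2 a ha.1) (ha.2 b hb.1))
        refine ⟨by omega, fun hnd hnS => ?_⟩
        by_cases hc : n + 1 ≤ (W.core S).card
        · omega
        have hne : F.Nonempty := by
          rw [hF, Finset.sdiff_nonempty]
          intro hsub
          have := Finset.card_le_card hsub
          omega
        obtain ⟨m, hm, hmax⟩ := F.exists_max_image r hne
        have : 0 < ({j ∈ F | ∀ i ∈ F, r i ≤ r j} : Finset ι).card :=
          Finset.card_pos.2 ⟨m, by simp [hm]; exact hmax⟩
        have := h4 (by omega) (by omega)
        omega
      · exact ⟨h3, fun _ _ => by omega⟩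

theorem card_subset_disjoint (B D : Finset ι) (hBD : Disjoint B D) (n : ℕ) (hn : B.card ≤ n) :
    ({I ∈ Finset.powersetCard n Finset.univ | B ⊆ I ∧ Disjoint I D} : Finset (Finset ι)).card =
      (Fintype.card ι - B.card - D.card).choose (n - B.card) := by
  have hc : (Finset.univ \ (B ∪ D)).card = Fintype.card ι - B.card - D.card := by
    rw [Finset.card_sdiff_of_subset (Finset.subset_univ _), Finset.card_union_of_disjoint hBD,
      Finset.card_univ]
    omega
  rw [← hc, ← Finset.card_powersetCard]
  refine Finset.card_bij' (fun I _ => I \ B) (fun J _ => J ∪ B) ?_ ?_ ?_ ?_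
  · intro I hI
    simp only [Finset.mem_filter, Finset.mem_powersetCard] at hI ⊢
    refine ⟨fun x hx => ?_, by rw [Finset.card_sdiff_of_subset hI.2.1, hI.1.2]⟩
    have := Finset.disjoint_left.1 hI.2.2
    simp only [Finset.mem_sdiff, Finset.mem_univ, Finset.mem_union] at hx ⊢
    tauto
  · intro J hJ
    simp only [Finset.mem_filter, Finset.mem_powersetCard] at hJ ⊢
    have hJB : Disjoint J B := Finset.disjoint_left.2 fun x hx => by
      have := hJ.1 hx
      simp at this; tauto
    refine ⟨⟨Finset.subset_univ _, by rw [Finset.card_union_of_disjoint hJB]; omega⟩,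
      Finset.subset_union_right, Finset.disjoint_left.2 fun x hx hx' => ?_⟩
    rcases Finset.mem_union.1 hx with h | h
    · have := hJ.1 h
      simp at this; tauto
    · exact Finset.disjoint_left.1 hBD h hx'
  · intro I hI
    simp only [Finset.mem_filter] at hI
    exact Finset.sdiff_union_of_subset hI.2.1
  · intro J hJ
    simp only [Finset.mem_powersetCard] at hJ
    refine Finset.union_sdiff_cancel_right (Finset.disjoint_left.2 fun x hx => ?_)
    have := hJ.1 hx
    simp at this; tauto

theorem card_filter_viol (W : ViolatorSystem ι) {d : ℕ}
    (hW : ∀ S, d ≤ S.card → (W.core S).card = d) (p : ℕ → Prop) [DecidablePred p] {n : ℕ}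
    (hn : d ≤ n) :
    ({I ∈ Finset.powersetCard n Finset.univ | p (W.viol I).card} : Finset (Finset ι)).card =
      ∑ v ∈ Finset.range (Fintype.card ι - d + 1) with p v,
        ({B ∈ Finset.powersetCard d Finset.univ | (W.viol B).card = v} : Finset (Finset ι)).card *
          (Fintype.card ι - d - v).choose (n - d) := by
  have hcore : ∀ B : Finset ι, B.card = d → W.core B = B := fun B hB =>
    Finset.eq_of_subset_of_card_le (W.core_subset B) (by rw [hW B hB.ge, hB])
  have hviol : ∀ I, W.viol (W.core I) = W.viol I := fun I =>
    W.viol_congr I _ subset_rfl (Disjoint.mono_left (W.core_subset I) (W.disjoint_viol I))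
  rw [Finset.card_eq_sum_card_fiberwise (f := W.core)
    (t := {B ∈ Finset.powersetCard d Finset.univ | p (W.viol B).card})]
  · have : ∀ B ∈ ({B ∈ Finset.powersetCard d Finset.univ | p (W.viol B).card} :
        Finset (Finset ι)),
        ({I ∈ ({I ∈ Finset.powersetCard n Finset.univ | p (W.viol I).card} : Finset (Finset ι)) |
          W.core I = B}).card =
          (Fintype.card ι - d - (W.viol B).card).choose (n - d) := by
      intro B hB
      simp only [Finset.mem_filter, Finset.mem_powersetCard] at hB
      have h := card_subset_disjoint B (W.viol B) (W.disjoint_viol B) n (by omega)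
      rw [hB.1.2] at h
      rw [← h]
      congr 1
      ext I
      simp only [Finset.mem_filter, ← W.core_eq_iff (hcore B hB.1.2)]
      constructor
      · rintro ⟨⟨h1, h2⟩, h3⟩
        exact ⟨h1, h3⟩
      · rintro ⟨h1, h3⟩
        refine ⟨⟨h1, ?_⟩, h3⟩
        rw [← hviol I, h3]
        exact hB.2
    rw [Finset.sum_congr rfl this]
    rw [← Finset.sum_fiberwise_of_maps_to (g := fun B => (W.viol B).card)
      (t := (Finset.range (Fintype.card ι - d + 1)).filter p)]
    · refine Finset.sum_congr rfl fun v hv => ?_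
      rw [Finset.sum_congr rfl (g := fun _ => (Fintype.card ι - d - v).choose (n - d))]
      · rw [Finset.sum_const, smul_eq_mul, Finset.filter_filter]
        congr 2
        ext B
        simp only [Finset.mem_filter] at hv ⊢
        grind
      · intro B hB
        rw [(Finset.mem_filter.1 hB).2]
    · intro B hB
      simp only [Finset.mem_filter, Finset.mem_powersetCard, Finset.mem_range] at hB ⊢
      refine ⟨?_, hB.2⟩
      have := Finset.card_le_univ (B ∪ W.viol B)
      rw [Finset.card_union_of_disjoint (W.disjoint_viol B)] at this
      omega
  · intro I hI
    simp only [Finset.coe_filter, Set.mem_ofPred_eq, Finset.mem_powersetCard] at hI ⊢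
    exact ⟨⟨Finset.subset_univ _, hW I (by omega)⟩, by rw [hviol]; exact hI.2⟩

theorem card_le_hyperTail (V : ViolatorSystem ι) {d N k : ℕ} (hd : 1 ≤ d) (hdN : d ≤ N)
    (hN : N ≤ Fintype.card ι) (hV : ∀ S, (V.core S).card ≤ d) :
    ({I ∈ Finset.powersetCard N Finset.univ | k ≤ (V.viol I).card} : Finset (Finset ι)).card ≤
      hyperTail (Fintype.card ι) N d k := by
  obtain ⟨d, rfl⟩ : ∃ e, d = e + 1 := ⟨d - 1, by omega⟩
  obtain ⟨W, hVW, hW⟩ := V.exists_regular hV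
  have hb := eq_choose_of_sum_mul_choose (hdN.trans hN)
    (fun v => ({B ∈ Finset.powersetCard (d + 1) Finset.univ | (W.viol B).card = v} :
      Finset (Finset ι)).card) (fun n hn hnM => by
        have := W.card_filter_viol hW (fun _ => True) hn
        simp only [Finset.filter_true, Finset.card_powersetCard, Finset.card_univ] at this
        exact this.symm)
  by_cases hk : k ≤ Fintype.card ι - (d + 1) + 1
  · rw [← sum_choose_mul_choose_eq_hyperTail _ N d k hdN hN hk]
    calc _ ≤ ({I ∈ Finset.powersetCard N Finset.univ | k ≤ (W.viol I).card} :
          Finset (Finset ι)).card :=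
          Finset.card_le_card (Finset.monotone_filter_right _ fun I _ h =>
            h.trans (Finset.card_le_card (hVW I)))
      _ = _ := W.card_filter_viol hW (k ≤ ·) hdN
      _ = _ := Finset.sum_congr rfl fun v hv => by
          rw [hb v (by simp at hv; omega)]
      _ ≤ _ := le_rfl
  · rw [Finset.filter_false_of_mem]
    · simp
    · intro I hI h
      have h1 := Finset.card_le_univ (I ∪ V.viol I)
      rw [Finset.card_union_of_disjoint (V.disjoint_viol I)] at h1
      have := (Finset.mem_powersetCard.1 hI).2
      omega

end ViolatorSystem

namespace ConvexProgram

open Module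

variable {ι E : Type*}

/-- `y S` is feasible for, and attains the minimum of, the program of minimizing `f` over `x ∈ Q`
subject to `g j x ≤ ρ j` for all `j ∈ S`. -/
structure IsSolution (Q : Set E) (f : E → ℝ) (g : ι → E → ℝ) (ρ : ι → ℝ) (y : Finset ι → E) :
    Prop where
  mem : ∀ S, y S ∈ Q
  le : ∀ S, ∀ j ∈ S, g j (y S) ≤ ρ j
  isMin : ∀ S, ∀ z ∈ Q, (∀ j ∈ S, g j z ≤ ρ j) → f (y S) ≤ f z

namespace IsSolution

variable {Q : Set E} {f : E → ℝ} {g : ι → E → ℝ} {ρ : ι → ℝ} {y : Finset ι → E}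

theorem mono (h : IsSolution Q f g ρ y) {S T : Finset ι} (hST : S ⊆ T) : f (y S) ≤ f (y T) :=
  h.isMin S _ (h.mem T) fun j hj => h.le T j (hST hj)

variable [AddCommGroup E] [Module ℝ E]

theorem unique (h : IsSolution Q f g ρ y) (hQ : Convex ℝ Q) (hf : StrictConvexOn ℝ Set.univ f)
    (hg : ∀ j, ConvexOn ℝ Set.univ (g j)) {S : Finset ι} {z : E} (hz : z ∈ Q)
    (hzS : ∀ j ∈ S, g j z ≤ ρ j) (hle : f z ≤ f (y S)) : z = y S := by
  have hconv : Convex ℝ {x ∈ Q | ∀ j ∈ S, g j x ≤ ρ j} := by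
    intro a ha b hb s t hs ht hst
    refine ⟨hQ ha.1 hb.1 hs ht hst, fun j hj => ?_⟩
    exact ((hg j).convex_le (ρ j) ⟨trivial, ha.2 j hj⟩ ⟨trivial, hb.2 j hj⟩ hs ht hst).2
  have hmin : IsMinOn f {x ∈ Q | ∀ j ∈ S, g j x ≤ ρ j} (y S) :=
    fun x hx => h.isMin S x hx.1 hx.2
  exact (hf.subset (Set.subset_univ _) hconv).eq_of_isMinOn
    (fun x hx => hle.trans (hmin hx)) hmin ⟨hz, hzS⟩ ⟨h.mem S, h.le S⟩

variable [DecidableEq ι]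

/-- A constraint that is inactive at the solution can be dropped. -/
theorem erase_eq_of_lt (h : IsSolution Q f g ρ y) (hQ : Convex ℝ Q)
    (hf : StrictConvexOn ℝ Set.univ f) (hg : ∀ j, ConvexOn ℝ Set.univ (g j)) {S : Finset ι} {j : ι}
    (hj : g j (y S) < ρ j) : y (S.erase j) = y S := by
  by_contra hne
  set z := y (S.erase j) with hz
  obtain ⟨t, ht0, ht1, ht⟩ : ∃ t : ℝ, 0 < t ∧ t < 1 ∧
      (1 - t) * g j (y S) + t * g j z ≤ ρ j := by
    have hc : Filter.Tendsto (fun t : ℝ => (1 - t) * g j (y S) + t * g j z)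
        (nhdsWithin 0 (Set.Ioi 0)) (nhds ((1 - 0) * g j (y S) + 0 * g j z)) := by
      refine Filter.Tendsto.mono_left (Continuous.tendsto ?_ 0) nhdsWithin_le_nhds
      fun_prop
    have h1 := hc.eventually_lt_const (u := ρ j) (by simpa using hj)
    obtain ⟨t, ht, ht'⟩ := (h1.and (Ioo_mem_nhdsGT (zero_lt_one (α := ℝ)))).exists
    exact ⟨t, ht'.1, ht'.2, ht.le⟩
  have hw : f (y S) ≤ f ((1 - t) • y S + t • z) := by
    refine h.isMin S _ (hQ (h.mem _) (h.mem _) (by linarith) ht0.le (by ring)) fun i hi => ?_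
    have hi' := (hg i).2 (Set.mem_univ (y S)) (Set.mem_univ z) (by linarith : 0 ≤ 1 - t) ht0.le
      (by ring)
    simp only [smul_eq_mul] at hi'
    rcases eq_or_ne i j with rfl | hij
    · exact hi'.trans ht
    · have h1 := h.le S i hi
      have h2 := h.le (S.erase j) i (Finset.mem_erase.2 ⟨hij, hi⟩)
      nlinarith
  have h2 := hf.2 (Set.mem_univ (y S)) (Set.mem_univ z) (Ne.symm hne) (by linarith : 0 < 1 - t) ht0
    (by ring)
  simp only [smul_eq_mul] at h2
  have h3 := h.mono (S.erase_subset j)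
  nlinarith

/-- Helly-type bound: an irredundant set of constraints has at most `finrank ℝ E` elements. -/
theorem card_le_finrank (h : IsSolution Q f g ρ y) (hQ : Convex ℝ Q)
    (hf : StrictConvexOn ℝ Set.univ f) (hg : ∀ j, ConvexOn ℝ Set.univ (g j)) [FiniteDimensional ℝ E]
    {C : Finset ι} (hC : ∀ j ∈ C, y (C.erase j) ≠ y C) : C.card ≤ finrank ℝ E := by
  by_contra! hlt
  let F : Option ι → Set E := fun o => o.elim {x ∈ Q | f x < f (y C)}
    fun j => {x ∈ Q | g j x ≤ ρ j}
  have hF : ∀ o, Convex ℝ (F o) := by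
    rintro (_ | j)
    · exact fun a ha b hb s t hs ht hst => ⟨hQ ha.1 hb.1 hs ht hst,
        (hf.convexOn.convex_lt (f (y C)) ⟨trivial, ha.2⟩ ⟨trivial, hb.2⟩ hs ht hst).2⟩
    · exact fun a ha b hb s t hs ht hst => ⟨hQ ha.1 hb.1 hs ht hst,
        ((hg j).convex_le (ρ j) ⟨trivial, ha.2⟩ ⟨trivial, hb.2⟩ hs ht hst).2⟩
  obtain ⟨x, hx⟩ := Convex.helly_theorem' (𝕜 := ℝ) (F := F) (s := C.insertNone)
    (fun o _ => hF o) (fun I hI hcard => by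
      have hne : ∃ o ∈ C.insertNone, o ∉ I := by
        by_contra! hsub
        have := Finset.card_le_card (s := C.insertNone) hsub
        rw [Finset.card_insertNone] at this
        omega
      obtain ⟨_ | j, hj, hjI⟩ := hne
      · refine ⟨y C, Set.mem_iInter₂.2 ?_⟩
        rintro (_ | i) hi
        · exact absurd hi hjI
        · exact ⟨h.mem C, h.le C i (by simpa using hI hi)⟩
      · have hjC : j ∈ C := by simpa using hj
        refine ⟨y (C.erase j), Set.mem_iInter₂.2 ?_⟩
        rintro (_ | i) hi
        · refine ⟨h.mem _, lt_of_not_ge fun hle => hC j hjC ?_⟩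
          exact (h.unique hQ hf hg (h.mem C)
            (fun i hi => h.le C i (Finset.mem_of_mem_erase hi)) hle).symm
        · refine ⟨h.mem _, h.le _ i (Finset.mem_erase.2 ⟨?_, by simpa using hI hi⟩)⟩
          rintro rfl
          exact hjI hi)
  rw [Set.mem_iInter₂] at hx
  have h0 : x ∈ Q ∧ f x < f (y C) := hx none (by simp)
  exact h0.2.not_ge (h.isMin C x h0.1 fun j hj => (hx (some j) (by simpa using hj)).2)

theorem exists_violatorSystem [Fintype ι] (h : IsSolution Q f g ρ y) (hQ : Convex ℝ Q)
    (hf : StrictConvexOn ℝ Set.univ f) (hg : ∀ j, ConvexOn ℝ Set.univ (g j)) [FiniteDimensional ℝ E]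
    (hgen : ∀ S, ∀ j ∉ S, g j (y S) ≠ ρ j) :
    ∃ V : ViolatorSystem ι, (∀ S, (V.core S).card ≤ finrank ℝ E) ∧
      ∀ S j, j ∈ V.viol S ↔ ρ j < g j (y S) := by
  classical
  have sandwich : ∀ {A B C : Finset ι}, A ⊆ B → B ⊆ C → y A = y C → y B = y C := by
    intro A B C hAB hBC hAC
    exact (h.unique hQ hf hg (h.mem C) (fun j hj => h.le C j (hBC hj))
      (hAC ▸ h.mono hAB)).symm
  let core : Finset ι → Finset ι := fun S => {j ∈ S | y (S.erase j) ≠ y S}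
  have core_sub : ∀ {C S : Finset ι}, C ⊆ S → y C = y S → core S ⊆ C := by
    intro C S hCS hy j hj
    by_contra hjC
    simp only [core, Finset.mem_filter] at hj
    exact hj.2 (sandwich (fun i hi => Finset.mem_erase.2
      ⟨fun hij => hjC (hij ▸ hi), hCS hi⟩) (S.erase_subset j) hy)
  have core_min : ∀ S, y (core S) = y S ∧ ∀ j ∈ core S, y ((core S).erase j) ≠ y (core S) := by
    intro S
    obtain ⟨C, hCm⟩ := Finset.exists_minimal
      (s := {C ∈ S.powerset | y C = y S}) ⟨S, by simp⟩
    have hC1 := hCm.1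
    simp only [Finset.mem_filter, Finset.mem_powerset] at hC1
    have hirr : ∀ j ∈ C, y (C.erase j) ≠ y C := by
      intro j hj hy
      have := hCm.2 (y := C.erase j) (by
        simp only [Finset.mem_filter, Finset.mem_powerset]
        exact ⟨(C.erase_subset j).trans hC1.1, hy.trans hC1.2⟩) (C.erase_subset j)
      exact Finset.notMem_erase j C (this hj)
    have : core S = C := by
      refine (core_sub hC1.1 hC1.2).antisymm fun j hj => ?_
      simp only [core, Finset.mem_filter]
      refine ⟨hC1.1 hj, fun hy => hirr j hj (h.erase_eq_of_lt hQ hf hg ?_)⟩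
      refine lt_of_le_of_ne (h.le C j hj) ?_
      rw [hC1.2, ← hy]
      exact hgen _ j (Finset.notMem_erase j S)
    rw [this]
    exact ⟨hC1.2, hirr⟩
  have y_congr : ∀ S T : Finset ι, core S ⊆ T →
      Disjoint T ({j | ρ j < g j (y S)} : Finset ι) → y T = y S := by
    intro S T hST hd
    refine (h.unique hQ hf hg (h.mem S) (fun j hj => ?_) ?_).symm
    · have := Finset.disjoint_left.1 hd hj
      simpa using this
    · rw [← (core_min S).1]
      exact h.mono hST
  refine ⟨⟨core, fun S => ({j | ρ j < g j (y S)} : Finset ι), fun S => Finset.filter_subset _ _,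
    fun S => ?_, fun S T hST hd => ?_, fun S T hST hd => by rw [y_congr S T hST hd]⟩,
    fun S => h.card_le_finrank hQ hf hg (core_min S).2, fun S j => by simp⟩
  · refine Finset.disjoint_left.2 fun j hj hj' => ?_
    simp only [Finset.mem_filter] at hj'
    exact (h.le S j hj).not_gt hj'.2
  · have hy := y_congr S T hST hd
    have h1 : core T ⊆ core S := core_sub hST ((core_min S).1.trans hy.symm)
    refine h1.antisymm (core_sub (h1.trans (Finset.filter_subset _ _)) ?_)
    rw [(core_min T).1, hy]

end IsSolution

end ConvexProgram

theorem exists_forall_notMem_of_update {ι κ : Type*} [Fintype ι] [DecidableEq ι] [Fintype κ]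
    {t : ℕ} (ht : Fintype.card κ < t) (j : κ → ι) (B : κ → Set (ι → Fin t))
    (hB : ∀ a, ∀ σ ∈ B a, ∀ τ ∈ B a, (∀ i, i ≠ j a → σ i = τ i) → σ = τ) :
    ∃ σ, ∀ a, σ ∉ B a := by
  classical
  by_contra! hcov
  have hcard : ∀ a, (B a).toFinset.card * t ≤ t ^ Fintype.card ι := by
    intro a
    have := Fintype.card_le_of_injective
      (fun p : (B a) × Fin t => Function.update (p.1 : ι → Fin t) (j a) p.2) (by
        rintro ⟨⟨σ, hσ⟩, v⟩ ⟨⟨τ, hτ⟩, w⟩ h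
        have hvw : v = w := by simpa using congrFun h (j a)
        have hστ : σ = τ := hB a σ hσ τ hτ fun i hi => by
          simpa [Function.update_of_ne hi] using congrFun h i
        simp [hvw, hστ])
    simpa [Fintype.card_prod, Set.toFinset_card] using this
  have hunion : t ^ Fintype.card ι ≤ ∑ a, (B a).toFinset.card := by
    have h : (Finset.univ : Finset (ι → Fin t)) ⊆ Finset.univ.biUnion fun a => (B a).toFinset := by
      intro σ _
      obtain ⟨a, ha⟩ := hcov σ
      simp only [Finset.mem_biUnion, Finset.mem_univ, true_and, Set.mem_toFinset]
      exact ⟨a, ha⟩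
    have := (Finset.card_le_card h).trans Finset.card_biUnion_le
    simpa using this
  have hpos : 0 < t ^ Fintype.card ι := pow_pos (by omega) _
  have : t ^ Fintype.card ι * t ≤ Fintype.card κ * t ^ Fintype.card ι := by
    calc _ ≤ (∑ a, (B a).toFinset.card) * t := Nat.mul_le_mul_right _ hunion
      _ = ∑ a, (B a).toFinset.card * t := Finset.sum_mul _ _ _
      _ ≤ ∑ _a : κ, t ^ Fintype.card ι := Finset.sum_le_sum fun a _ => hcard a
      _ = _ := by simp
  nlinarith

theorem convexOn_infDist {E : Type*} [NormedAddCommGroup E] [NormedSpace ℝ E] {K : Set E}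
    (hK : Convex ℝ K) (hc : IsCompact K) (hne : K.Nonempty) :
    ConvexOn ℝ Set.univ fun x => Metric.infDist x K := by
  refine ⟨convex_univ, fun x _ y _ a b ha hb hab => ?_⟩
  obtain ⟨p, hp, hxp⟩ := hc.exists_infDist_eq_dist hne x
  obtain ⟨q, hq, hyq⟩ := hc.exists_infDist_eq_dist hne y
  calc Metric.infDist (a • x + b • y) K ≤ dist (a • x + b • y) (a • p + b • q) :=
        Metric.infDist_le_dist_of_mem (hK hp hq ha hb hab)
    _ ≤ dist (a • x) (a • p) + dist (b • y) (b • q) := dist_add_add_le _ _ _ _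
    _ = _ := by
        simp only [dist_smul₀, Real.norm_of_nonneg ha, Real.norm_of_nonneg hb, hxp, hyq,
          smul_eq_mul]

namespace ConvexProgram

theorem exists_pos_lt_of_forall_ne_zero {ι E : Type*} [TopologicalSpace E] {Q : Set E}
    (hQ : IsCompact Q) (hne : Q.Nonempty) {g : ι → E → ℝ} (hgc : ∀ j, Continuous (g j))
    (hg0 : ∀ j z, 0 ≤ g j z) {ℓ : E → ℝ} (hℓ : Continuous ℓ) {S : Finset ι} {j : ι} {b : ℝ}
    (hb : 0 ≤ b) (h : ∀ z ∈ Q, (∀ i ∈ S, g i z = 0) → ℓ z ≤ 0 → g j z ≠ 0) :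
    ∃ R : ℝ, 0 < R ∧ ∀ z ∈ Q, (∀ i ∈ S, g i z ≤ R) → ℓ z ≤ R * b → R < g j z := by
  let H : E → ℝ := fun z => ∑ i ∈ S, g i z + g j z + max 0 (ℓ z)
  have hHc : Continuous H := by fun_prop
  obtain ⟨w, hw, hmin⟩ := hQ.exists_isMinOn hne hHc.continuousOn
  have hpos : 0 < H w := by
    by_contra! hle
    have h1 : 0 ≤ ∑ i ∈ S, g i w := Finset.sum_nonneg fun i _ => hg0 i w
    have h2 := hg0 j w
    have h3 := le_max_left 0 (ℓ w)
    have h4 := le_max_right 0 (ℓ w)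
    simp only [H] at hle
    have h5 : ∑ i ∈ S, g i w = 0 := by linarith
    exact h w hw ((Finset.sum_eq_zero_iff_of_nonneg fun i _ => hg0 i w).1 h5) (by linarith)
      (by linarith)
  have hden : (0 : ℝ) < S.card + 2 + b := by positivity
  have hRpos : 0 < H w / (S.card + 2 + b) := div_pos hpos hden
  refine ⟨_, hRpos, fun z hz h1 h2 => ?_⟩
  have hRw : H w / (S.card + 2 + b) * (S.card + 2 + b) = H w := div_mul_cancel₀ _ hden.ne'
  generalize H w / (S.card + 2 + b) = R at *
  have h3 : ∑ i ∈ S, g i z ≤ S.card * R := by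
    simpa using Finset.sum_le_sum h1
  have h4 : max 0 (ℓ z) ≤ R * b := max_le (by positivity) h2
  have h5 : H w ≤ ∑ i ∈ S, g i z + g j z + max 0 (ℓ z) := hmin hz
  nlinarith

open scoped Classical in
theorem exists_violatorSystem_of_unique_minimizer {ι E : Type*} [Fintype ι] [NormedAddCommGroup E]
    [InnerProductSpace ℝ E] [FiniteDimensional ℝ E] (c : E) {X : Set E} (hX : Convex ℝ X)
    {K : ι → Set E} (hK : ∀ j, Convex ℝ (K j)) (x : Finset ι → E) (hxX : ∀ S, x S ∈ X)
    (hxK : ∀ S, ∀ j ∈ S, x S ∈ K j)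
    (huniq : ∀ S, ∀ z ∈ X, (∀ j ∈ S, z ∈ K j) → ⟪c, z⟫ ≤ ⟪c, x S⟫ → z = x S) :
    ∃ V : ViolatorSystem ι, (∀ S, (V.core S).card ≤ Module.finrank ℝ E) ∧
      ∀ S j, x S ∉ K j → j ∈ V.viol S := by
  let Q : Set E := convexHull ℝ (Set.range x)
  let L : ι → Set E := fun j => convexHull ℝ (x '' {S | x S ∈ K j})
  have hQX : Q ⊆ X := convexHull_min (by rintro _ ⟨S, rfl⟩; exact hxX S) hX
  have hLK : ∀ j, L j ⊆ K j := fun j => convexHull_min (by rintro _ ⟨S, hS, rfl⟩; exact hS) (hK j)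
  have hxQ : ∀ S, x S ∈ Q := fun S => subset_convexHull ℝ _ ⟨S, rfl⟩
  have hxL : ∀ S j, x S ∈ K j → x S ∈ L j := fun S j h => subset_convexHull ℝ _ ⟨S, h, rfl⟩
  have hQc : IsCompact Q := (Set.finite_range x).isCompact_convexHull ℝ
  have hLc : ∀ j, IsCompact (L j) := fun j => (Set.toFinite _).isCompact_convexHull ℝ
  have hLne : ∀ j, (L j).Nonempty := fun j => ⟨_, hxL Finset.univ j (hxK _ j (Finset.mem_univ j))⟩
  let g : ι → E → ℝ := fun j z => Metric.infDist z (L j)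
  have hg : ∀ j, ConvexOn ℝ Set.univ (g j) := fun j =>
    convexOn_infDist (convex_convexHull ℝ _) (hLc j) (hLne j)
  have hgc : ∀ j, Continuous (g j) := fun j => Metric.continuous_infDist_pt _
  have hg0 : ∀ j z, 0 ≤ g j z := fun j z => Metric.infDist_nonneg
  have hgmem : ∀ j z, g j z = 0 → z ∈ L j := fun j z h =>
    ((hLc j).isClosed.mem_iff_infDist_zero (hLne j)).2 h
  have hgx : ∀ S, ∀ j ∈ S, g j (x S) = 0 := fun S j hj =>
    Metric.infDist_zero_of_mem (hxL S j (hxK S j hj))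
  -- A small perturbation of the constraints and of the objective keeps all violations.
  have hgap : ∀ S j, ∃ R : ℝ, 0 < R ∧ (x S ∉ K j → ∀ z ∈ Q, (∀ i ∈ S, g i z ≤ R) →
      ⟪c, z⟫ ≤ ⟪c, x S⟫ + R * ‖x S‖ ^ 2 → R < g j z) := by
    intro S j
    by_cases hSj : x S ∈ K j
    · exact ⟨1, one_pos, fun h => absurd hSj h⟩
    obtain ⟨R, hR0, hR⟩ := exists_pos_lt_of_forall_ne_zero hQc ⟨_, hxQ S⟩ hgc hg0
      (ℓ := fun z => ⟪c, z⟫ - ⟪c, x S⟫) (by fun_prop) (S := S) (j := j) (sq_nonneg ‖x S‖)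
      fun z hz h1 h2 h3 => by
        have hzx : z = x S := huniq S z (hQX hz) (fun i hi => hLK i (hgmem i z (h1 i hi)))
          (by linarith)
        exact hSj (hzx ▸ hLK j (hgmem j z h3))
    exact ⟨R, hR0, fun _ z hz h1 h2 => hR z hz h1 (by linarith)⟩
  choose R hR0 hR using hgap
  obtain ⟨r, hr0, hr⟩ : ∃ r : ℝ, 0 < r ∧ ∀ S j, r ≤ R S j := by
    have : ∀ᶠ r in nhdsWithin (0 : ℝ) (Set.Ioi 0), ∀ S j, r ≤ R S j :=
      Filter.eventually_all.2 fun S => Filter.eventually_all.2 fun j =>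
        Filter.Eventually.filter_mono nhdsWithin_le_nhds (eventually_le_nhds (hR0 S j))
    obtain ⟨r, h1, h2⟩ := (this.and self_mem_nhdsWithin).exists
    exact ⟨r, h2, h1⟩
  let f : E → ℝ := fun z => ⟪c, z⟫ + r * ‖z‖ ^ 2
  have hfc : Continuous f := by fun_prop
  have hf : StrictConvexOn ℝ Set.univ f := by
    refine StrongConvexOn.strictConvexOn (m := 2 * r) ?_ (by positivity)
    rw [strongConvexOn_iff_convex]
    have : (fun z => f z - 2 * r / 2 * ‖z‖ ^ 2) = fun z => innerₛₗ ℝ c z := by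
      ext z
      simp [f]
    rw [this]
    exact LinearMap.convexOn _ convex_univ
  have hsol : ∀ ρ : ι → ℝ, ∃ y : Finset ι → E, (∀ j, 0 ≤ ρ j) → IsSolution Q f g ρ y := by
    intro ρ
    by_cases hρ : ∀ j, 0 ≤ ρ j
    · have : ∀ S : Finset ι, ∃ z ∈ {z ∈ Q | ∀ j ∈ S, g j z ≤ ρ j},
          IsMinOn f {z ∈ Q | ∀ j ∈ S, g j z ≤ ρ j} z := by
        intro S
        have hne : {z ∈ Q | ∀ j ∈ S, g j z ≤ ρ j}.Nonempty :=
          ⟨x S, hxQ S, fun j hj => (hgx S j hj).trans_le (hρ j)⟩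
        refine IsCompact.exists_isMinOn ?_ hne hfc.continuousOn
        refine hQc.inter_right (t := {z | ∀ j ∈ S, g j z ≤ ρ j}) ?_
        simp only [Set.ofPred_forall]
        exact isClosed_biInter fun j _ => isClosed_le (hgc j) continuous_const
      choose y hy hymin using this
      exact ⟨y, fun _ => ⟨fun S => (hy S).1, fun S => (hy S).2,
        fun S z hz hzS => hymin S ⟨hz, hzS⟩⟩⟩
    · exact ⟨x, fun h => absurd h hρ⟩
  choose y hy using hsol
  let t := Fintype.card (Finset ι × ι) + 1
  have ht : (0 : ℝ) < t := by positivity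
  let ρ : (ι → Fin t) → ι → ℝ := fun σ j => r * ((σ j : ℝ) / t)
  have hρ0 : ∀ σ j, 0 ≤ ρ σ j := fun σ j => by positivity
  have hρr : ∀ σ j, ρ σ j ≤ r := fun σ j =>
    mul_le_of_le_one_right hr0.le ((div_le_one ht).2 (by exact_mod_cast (σ j).2.le))
  have hρinj : ∀ σ τ j, ρ σ j = ρ τ j → σ j = τ j := by
    intro σ τ j h
    have := mul_left_cancel₀ hr0.ne' h
    rw [div_left_inj' ht.ne'] at this
    exact Fin.ext (by exact_mod_cast this)
  obtain ⟨σ, hσ⟩ := exists_forall_notMem_of_update (t := t) (Nat.lt_succ_self _)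
    (fun a : Finset ι × ι => a.2)
    (fun a => {σ | a.2 ∉ a.1 ∧ g a.2 (y (ρ σ) a.1) = ρ σ a.2}) (by
      rintro ⟨S, j⟩ σ ⟨hjS, hσ⟩ τ ⟨-, hτ⟩ hστ
      have hρS : ∀ i ∈ S, ρ σ i = ρ τ i := fun i hi => by
        simp only [ρ, hστ i (fun h => hjS (h ▸ hi))]
      have hyy : y (ρ τ) S = y (ρ σ) S :=
        (hy _ (hρ0 σ)).unique (convex_convexHull ℝ _) hf hg ((hy _ (hρ0 τ)).mem S)
          (fun i hi => (hρS i hi) ▸ (hy _ (hρ0 τ)).le S i hi)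
          ((hy _ (hρ0 τ)).isMin S _ ((hy _ (hρ0 σ)).mem S)
            fun i hi => (hρS i hi) ▸ (hy _ (hρ0 σ)).le S i hi)
      funext i
      by_cases hi : i = j
      · subst hi
        refine hρinj σ τ i ?_
        rw [← hσ, ← hτ]
        simp only [hyy]
      · exact hστ i hi)
  have hys := hy _ (hρ0 σ)
  obtain ⟨V, hV, hviol⟩ := hys.exists_violatorSystem (convex_convexHull ℝ _) hf hg
    (fun S j hj h => hσ (S, j) ⟨hj, h⟩)
  refine ⟨V, hV, fun S j hSj => (hviol S j).2 ?_⟩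
  refine (hρr σ j).trans_lt ((hr S j).trans_lt (hR S j hSj _ (hys.mem S)
    (fun i hi => (hys.le S i hi).trans ((hρr σ i).trans (hr S j))) ?_))
  have h1 : f (y (ρ σ) S) ≤ f (x S) :=
    hys.isMin S _ (hxQ S) fun i hi => (hgx S i hi).trans_le (hρ0 σ i)
  have h2 : r * ‖x S‖ ^ 2 ≤ R S j * ‖x S‖ ^ 2 := mul_le_mul_of_nonneg_right (hr S j) (by positivity)
  have h3 : 0 ≤ r * ‖y (ρ σ) S‖ ^ 2 := by positivity
  simp only [f] at h1
  linarith

end ConvexProgram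

open Filter Topology in
theorem tendsto_choose_div_pow {a : ℕ → ℕ} {α : ℝ}
    (ha : Tendsto (fun m => (a m : ℝ) / m) atTop (𝓝 α)) (i : ℕ) :
    Tendsto (fun m => ((a m).choose i : ℝ) / (m : ℝ) ^ i) atTop (𝓝 (α ^ i / i.factorial)) := by
  induction i with
  | zero => simp
  | succ i ih =>
    have hi : Tendsto (fun m : ℕ => (i : ℝ) / m) atTop (𝓝 0) :=
      tendsto_const_div_atTop_nhds_zero_nat _
    have h := (ih.mul (ha.sub hi)).div_const ((i : ℝ) + 1)
    have hlim : α ^ i / i.factorial * (α - 0) / ((i : ℝ) + 1) =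
        α ^ (i + 1) / (i + 1).factorial := by
      rw [Nat.factorial_succ]
      push_cast
      field_simp
      ring
    rw [hlim] at h
    refine h.congr fun m => ?_
    have hc : ((a m).choose (i + 1) : ℝ) * (i + 1) = (a m).choose i * ((a m : ℝ) - i) := by
      rcases le_or_gt i (a m) with hle | hlt
      · rw [← Nat.cast_sub hle]
        exact_mod_cast Nat.choose_succ_right_eq (a m) i
      · simp [Nat.choose_eq_zero_of_lt hlt, Nat.choose_eq_zero_of_lt (hlt.trans i.lt_succ_self)]
    rw [← sub_div, div_mul_div_comm, ← hc, pow_succ]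
    field_simp

open Filter Topology in
theorem tendsto_hyperTail_div_choose {N d : ℕ} (hdN : d ≤ N) {ε : ℝ} (h0 : 0 ≤ ε)
    (h1 : ε ≤ 1) :
    Tendsto (fun m : ℕ => (hyperTail (N + m) N d ⌈ε * m⌉₊ : ℝ) / (N + m).choose N) atTop
      (𝓝 (∑ i ∈ Finset.range d, (N.choose i : ℝ) * ε ^ i * (1 - ε) ^ (N - i))) := by
  have hm : ∀ᶠ m : ℕ in atTop, (m : ℝ) ≠ 0 := by
    filter_upwards [eventually_gt_atTop 0] with m hm
    positivity
  have hconst : ∀ x : ℝ, Tendsto (fun m : ℕ => x / m) atTop (𝓝 0) :=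
    fun x => tendsto_const_div_atTop_nhds_zero_nat _
  have hk : Tendsto (fun m : ℕ => (⌈ε * m⌉₊ : ℝ) / m) atTop (𝓝 ε) :=
    (tendsto_nat_ceil_mul_div_atTop h0).comp tendsto_natCast_atTop_atTop
  have hM : Tendsto (fun m : ℕ => ((N + m : ℕ) : ℝ) / m) atTop (𝓝 1) := by
    have := (hconst N).add_const (1 : ℝ)
    rw [zero_add] at this
    refine this.congr' ?_
    filter_upwards [hm] with m hm
    push_cast
    field_simp
  simp only [hyperTail, Nat.cast_sum, Finset.sum_div]
  refine tendsto_finsetSum _ fun i hi => ?_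
  have hid : i < d := Finset.mem_range.1 hi
  have hK : Tendsto (fun m : ℕ => ((⌈ε * m⌉₊ + d - 1 : ℕ) : ℝ) / m) atTop (𝓝 ε) := by
    have := hk.add (hconst (d - 1 : ℕ))
    rw [add_zero] at this
    refine this.congr fun m => ?_
    rw [Nat.add_sub_assoc (by omega)]
    push_cast
    ring
  have hL : Tendsto (fun m : ℕ => ((N + m - (⌈ε * m⌉₊ + d - 1) : ℕ) : ℝ) / m) atTop
      (𝓝 (1 - ε)) := by
    refine (hM.sub hK).congr fun m => ?_
    have : ⌈ε * m⌉₊ ≤ m := Nat.ceil_le.2 (mul_le_of_le_one_left (Nat.cast_nonneg m) h1)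
    rw [← sub_div, Nat.cast_sub (show ⌈ε * m⌉₊ + d - 1 ≤ N + m by omega)]
  have h := ((tendsto_choose_div_pow hK i).mul (tendsto_choose_div_pow hL (N - i))).div
    (tendsto_choose_div_pow hM N) (by positivity)
  have hlim : ε ^ i / i.factorial * ((1 - ε) ^ (N - i) / (N - i).factorial) /
      (1 ^ N / N.factorial) = (N.choose i : ℝ) * ε ^ i * (1 - ε) ^ (N - i) := by
    rw [Nat.cast_choose ℝ (by omega : i ≤ N)]
    field_simp
    simp
  rw [hlim] at h
  refine h.congr' ?_
  filter_upwards [hm] with m hm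
  have hpow : (m : ℝ) ^ N = m ^ i * m ^ (N - i) := by rw [← pow_add]; congr 1; omega
  push_cast
  rw [Pi.div_apply, hpow]
  field_simp

open Filter Topology in
/-- The probability that a binomial variable of mean `m * p` falls below `m * ε` with `ε < p`
tends to zero. -/
theorem tendsto_measure_le_card_filter {Δ : Type*} [MeasurableSpace Δ] (P : Measure Δ)
    [IsProbabilityMeasure P] {S : Set Δ} (hS : MeasurableSet S) {ε : ℝ} (h0 : 0 ≤ ε)
    (hε : ENNReal.ofReal ε < P S) [DecidablePred (· ∈ S)] :
    Tendsto (fun m : ℕ => (Measure.pi fun _ : Fin m => P)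
      {η | ⌈ε * m⌉₊ ≤ ({j | η j ∈ S} : Finset (Fin m)).card}) atTop (𝓝 1) := by
  set p := P.real S with hp
  have hεp : ε < p := by
    rw [hp, measureReal_def]
    exact (ENNReal.ofReal_lt_iff_lt_toReal h0 (measure_ne_top _ _)).1 hε
  set f : Δ → ℝ := S.indicator 1 with hf
  have hfm : Measurable f := measurable_one.indicator hS
  have hf01 : ∀ δ, f δ ∈ Set.Icc (0 : ℝ) 1 := by
    intro δ
    by_cases h : δ ∈ S <;> simp [hf, h]
  have hfL : MemLp f 2 P := memLp_of_bounded (ae_of_all _ hf01) hfm.aestronglyMeasurable _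
  have hfint : ∫ δ, f δ ∂P = p := by simp [hf, integral_indicator_one hS, hp]
  have hbound : ∀ m : ℕ, 0 < m → 1 - ENNReal.ofReal (1 / (p - ε) ^ 2 / m) ≤
      (Measure.pi fun _ : Fin m => P)
        {η | ⌈ε * m⌉₊ ≤ ({j | η j ∈ S} : Finset (Fin m)).card} := by
    intro m hm
    set μ := Measure.pi fun _ : Fin m => P
    set Y : (Fin m → Δ) → ℝ := ∑ j, fun η => f (η j) with hY
    have hYc : ∀ η, Y η = ({j | η j ∈ S} : Finset (Fin m)).card := by
      intro η
      simp [hY, hf, Set.indicator_apply, Finset.sum_boole]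
    have hmp : ∀ j : Fin m, MeasurePreserving (fun η : Fin m → Δ => η j) μ P :=
      fun j => measurePreserving_eval (fun _ : Fin m => P) j
    have hYL : MemLp Y 2 μ := memLp_finsetSum' _ fun j _ => hfL.comp_measurePreserving (hmp j)
    have hYint : ∫ η, Y η ∂μ = m * p := by
      simp only [hY, Finset.sum_apply]
      rw [integral_finsetSum]
      · have : ∀ j : Fin m, ∫ η, f (η j) ∂μ = p := fun j => by
          rw [← hfint, ← (hmp j).map_eq,
            integral_map (hmp j).measurable.aemeasurable hfm.aestronglyMeasurable]
        simp [this]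
      · exact fun j _ => (hfL.comp_measurePreserving (hmp j)).integrable one_le_two
    have hvar : ProbabilityTheory.variance Y μ ≤ m := by
      rw [hY, ProbabilityTheory.variance_sum_pi fun _ => hfL]
      calc _ ≤ ∑ _j : Fin m, (1 : ℝ) := by
            refine Finset.sum_le_sum fun j _ => ?_
            have := ProbabilityTheory.variance_le_sq_of_bounded (ae_of_all P hf01)
              hfm.aemeasurable
            norm_num at this
            linarith
        _ = m := by simp
    have hpos : 0 < m * (p - ε) := mul_pos (by exact_mod_cast hm) (sub_pos.2 hεp)
    have hcheb := ProbabilityTheory.meas_ge_le_variance_div_sq hYL hpos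
    have hle : ENNReal.ofReal (ProbabilityTheory.variance Y μ / (m * (p - ε)) ^ 2) ≤
        ENNReal.ofReal (1 / (p - ε) ^ 2 / m) := by
      refine ENNReal.ofReal_le_ofReal ?_
      have hm' : (0 : ℝ) < m := by exact_mod_cast hm
      have hpe := sub_pos.2 hεp
      calc _ ≤ m / (m * (p - ε)) ^ 2 := by gcongr
        _ = _ := by field_simp
    set B := {η | m * (p - ε) ≤ |Y η - ∫ η, Y η ∂μ|} with hB
    have hsub : Bᶜ ⊆ {η | ⌈ε * m⌉₊ ≤ ({j | η j ∈ S} : Finset (Fin m)).card} := by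
      intro η hη
      simp only [hB, Set.mem_compl_iff, Set.mem_ofPred_eq, not_le, hYint, abs_lt] at hη
      rw [Set.mem_ofPred_eq, Nat.ceil_le, ← hYc]
      linarith [hη.1]
    have hone : 1 ≤ μ B + μ Bᶜ := by
      rw [← measure_univ (μ := μ), ← Set.union_compl_self B]
      exact measure_union_le _ _
    calc _ ≤ 1 - μ B := tsub_le_tsub_left (hcheb.trans hle) _
      _ ≤ μ Bᶜ := tsub_le_iff_left.2 hone
      _ ≤ _ := measure_mono hsub
  refine tendsto_of_tendsto_of_tendsto_of_le_of_le' ?_ tendsto_const_nhds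
    ((eventually_gt_atTop 0).mono hbound) (Eventually.of_forall fun m => prob_le_one)
  have h := ENNReal.tendsto_ofReal (tendsto_const_div_atTop_nhds_zero_nat (1 / (p - ε) ^ 2))
  have := ENNReal.Tendsto.sub (tendsto_const_nhds (x := (1 : ENNReal)) (f := atTop (α := ℕ))) h
    (Or.inl ENNReal.one_ne_top)
  simpa using this

open Classical in
/-- If among the splittings `e t` of a family of i.i.d. samples at most `B` put it into `E`, then
the expected number of such splittings is at most `B`. -/
theorem card_mul_measure_prod_pi_le {α β κ T Δ : Type*} [Fintype α] [Fintype β] [Fintype κ]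
    [Fintype T] [MeasurableSpace Δ] (P : Measure Δ) [IsProbabilityMeasure P]
    (e : T → α ⊕ β ≃ κ) {E : Set ((α → Δ) × (β → Δ))} (hE : MeasurableSet E)
    {B : ℕ}
    (hB : ∀ ω : κ → Δ,
      ({t | (fun a => ω (e t (.inl a)), fun b => ω (e t (.inr b))) ∈ E} : Finset T).card ≤ B) :
    Fintype.card T * ((Measure.pi fun _ : α => P).prod (Measure.pi fun _ : β => P)) E ≤ B := by
  set φ : T → (κ → Δ) → (α → Δ) × (β → Δ) :=
    fun t ω => (fun a => ω (e t (.inl a)), fun b => ω (e t (.inr b))) with hφ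
  have hmp : ∀ t, MeasurePreserving (φ t) (Measure.pi fun _ => P)
      ((Measure.pi fun _ : α => P).prod (Measure.pi fun _ : β => P)) := fun t =>
    (measurePreserving_sumPiEquivProdPi fun _ : α ⊕ β => P).comp
      ((measurePreserving_piCongrLeft (fun _ : κ => P) (e t)).symm)
  calc _ = ∑ t, (Measure.pi fun _ : κ => P) (φ t ⁻¹' E) := by
        simp [(hmp _).measure_preimage hE.nullMeasurableSet]
    _ = ∫⁻ ω, ∑ t, (φ t ⁻¹' E).indicator 1 ω ∂Measure.pi fun _ : κ => P := by
        rw [lintegral_finsetSum _ fun t _ => measurable_one.indicator ((hmp t).measurable hE)]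
        simp [lintegral_indicator_one ((hmp _).measurable hE)]
    _ ≤ ∫⁻ _, (B : ENNReal) ∂Measure.pi fun _ : κ => P := by
        refine lintegral_mono fun ω => ?_
        have := hB ω
        simp only [Set.indicator_apply, Set.mem_preimage, Pi.one_apply, Finset.sum_boole]
        exact_mod_cast this
    _ = B := by simp

open Classical in
theorem measurableSet_le_card_filter {α Δ β : Type*} [MeasurableSpace α] [MeasurableSpace Δ]
    [Fintype β] {W : Set (α × Δ)} (hW : MeasurableSet W) (k : ℕ) :
    MeasurableSet {p : α × (β → Δ) | k ≤ ({j | (p.1, p.2 j) ∈ W} : Finset β).card} := by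
  have h : Measurable fun p : α × (β → Δ) => ({j | (p.1, p.2 j) ∈ W} : Finset β).card := by
    simp only [Finset.card_filter]
    refine Finset.measurable_sum _ fun j _ => Measurable.ite ?_ measurable_const measurable_const
    exact (measurable_fst.prodMk ((measurable_pi_apply j).comp measurable_snd)) hW
  exact h measurableSet_Ici

open Classical Filter in
/-- A learning rule whose number of errors on fresh samples has hypergeometric tails has a
probability of error with binomial tail. -/
theorem measure_lt_measure_section_le {Δ : Type*} [MeasurableSpace Δ] (P : Measure Δ)
    [IsProbabilityMeasure P] {N d : ℕ} (hdN : d ≤ N) {ε : ℝ} (h0 : 0 ≤ ε) (h1 : ε ≤ 1)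
    {W : Set ((Fin N → Δ) × Δ)} (hW : MeasurableSet W)
    (hle : ∀ m k : ℕ, k ≤ m → ((N + m).choose N : ENNReal) *
      ((Measure.pi fun _ : Fin N => P).prod (Measure.pi fun _ : Fin m => P))
        {p | k ≤ ({j | (p.1, p.2 j) ∈ W} : Finset (Fin m)).card} ≤ hyperTail (N + m) N d k) :
    (Measure.pi fun _ : Fin N => P) {ω | ENNReal.ofReal ε < P {δ | (ω, δ) ∈ W}} ≤
      ENNReal.ofReal
        (∑ i ∈ Finset.range d, (N.choose i : ℝ) * ε ^ i * (1 - ε) ^ (N - i)) := by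
  set μ := Measure.pi fun _ : Fin N => P
  set A : Set (Fin N → Δ) := {ω | ENNReal.ofReal ε < P {δ | (ω, δ) ∈ W}} with hA
  have hAm : MeasurableSet A := (measurable_measure_prodMk_left hW) measurableSet_Ioi
  set E : ∀ m : ℕ, Set ((Fin N → Δ) × (Fin m → Δ)) := fun m =>
    {p | ⌈ε * m⌉₊ ≤ ({j | (p.1, p.2 j) ∈ W} : Finset (Fin m)).card} with hE
  have hEm : ∀ m, MeasurableSet (E m) := fun m => measurableSet_le_card_filter hW _
  set Q : ℕ → (Fin N → Δ) → ENNReal := fun m ω =>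
    (Measure.pi fun _ : Fin m => P) (Prod.mk ω ⁻¹' E m) with hQ
  have hlim : ∀ ω ∈ A, Tendsto (fun m => Q m ω) atTop (nhds 1) := by
    intro ω hω
    exact tendsto_measure_le_card_filter P (S := {δ | (ω, δ) ∈ W})
      (measurable_prodMk_left hW) h0 hω
  have hbound : ∀ m, ∫⁻ ω, Q m ω ∂μ ≤
      ENNReal.ofReal ((hyperTail (N + m) N d ⌈ε * m⌉₊ : ℝ) / (N + m).choose N) := by
    intro m
    have hpos : 0 < (N + m).choose N := Nat.choose_pos (by omega)
    rw [← Measure.prod_apply (hEm m), ENNReal.ofReal_div_of_pos (by exact_mod_cast hpos),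
      ENNReal.ofReal_natCast, ENNReal.ofReal_natCast,
      ENNReal.le_div_iff_mul_le (by simp [hpos.ne']) (by simp), mul_comm]
    exact hle m _ (Nat.ceil_le.2 (mul_le_of_le_one_left (Nat.cast_nonneg m) h1))
  calc μ A = ∫⁻ ω, A.indicator 1 ω ∂μ := (lintegral_indicator_one hAm).symm
    _ ≤ ∫⁻ ω, liminf (fun m => Q m ω) atTop ∂μ := by
        refine lintegral_mono fun ω => ?_
        refine Set.indicator_le (s := A) (f := 1) (g := fun ω => liminf (fun m => Q m ω) atTop)
          (fun ω hω => ?_) ω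
        exact (hlim ω hω).liminf_eq.ge
    _ ≤ liminf (fun m => ∫⁻ ω, Q m ω ∂μ) atTop :=
        lintegral_liminf_le fun m => measurable_measure_prodMk_left (hEm m)
    _ ≤ liminf (fun m => ENNReal.ofReal
          ((hyperTail (N + m) N d ⌈ε * m⌉₊ : ℝ) / (N + m).choose N)) atTop :=
        liminf_le_liminf (Eventually.of_forall hbound)
    _ = _ := (ENNReal.tendsto_ofReal (tendsto_hyperTail_div_choose hdN h0 h1)).liminf_eq

section Sampling

variable {Δ : Type*} {d : ℕ} {c : EuclideanSpace ℝ (Fin d)}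
  {X : Set (EuclideanSpace ℝ (Fin d))} {Xδ : Δ → Set (EuclideanSpace ℝ (Fin d))}
  {xN : ∀ N : ℕ, (Fin N → Δ) → EuclideanSpace ℝ (Fin d)}

open Classical in
/-- Among the ways of splitting `N + m` constraints into `N` sampled ones and `m` test ones, those
for which at least `k` test constraints are violated are controlled by a hypergeometric tail. -/
theorem card_filter_violation_le_hyperTail (hd : 1 ≤ d) (hX : Convex ℝ X)
    (hXδ : ∀ δ, Convex ℝ (Xδ δ))
    (hfeas : ∀ (N : ℕ) (ωs : Fin N → Δ), xN N ωs ∈ X ∩ ⋂ i, Xδ (ωs i))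
    (huniq : ∀ (N : ℕ) (ωs : Fin N → Δ), ∀ y ∈ X ∩ ⋂ i, Xδ (ωs i),
      ⟪c, y⟫ ≤ ⟪c, xN N ωs⟫ → y = xN N ωs)
    {N m : ℕ} (hdN : d ≤ N) (k : ℕ)
    (e : {I : Finset (Fin (N + m)) // I.card = N} → Fin N ⊕ Fin m ≃ Fin (N + m))
    (he : ∀ I i, e I (.inl i) = I.1.orderEmbOfFin I.2 i) (ω : Fin (N + m) → Δ) :
    ({I | k ≤ ({j | xN N (fun i => ω (e I (.inl i))) ∉ Xδ (ω (e I (.inr j)))} :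
      Finset (Fin m)).card} : Finset {I : Finset (Fin (N + m)) // I.card = N}).card ≤
      hyperTail (N + m) N d k := by
  set x : Finset (Fin (N + m)) → EuclideanSpace ℝ (Fin d) :=
    fun S => xN S.card fun i => ω (S.orderEmbOfFin rfl i) with hx
  have hmem : ∀ (S : Finset (Fin (N + m))), ∀ j ∈ S, ∃ i, S.orderEmbOfFin rfl i = j := by
    intro S j hj
    have : j ∈ Set.range (S.orderEmbOfFin rfl) := by simpa using hj
    exact this
  obtain ⟨V, hVcard, hVviol⟩ := ConvexProgram.exists_violatorSystem_of_unique_minimizer c hX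
    (K := fun j => Xδ (ω j)) (fun j => hXδ _) x (fun S => (hfeas _ _).1)
    (fun S j hj => by
      obtain ⟨i, rfl⟩ := hmem S j hj
      exact Set.mem_iInter.1 (hfeas S.card fun i => ω (S.orderEmbOfFin rfl i)).2 i)
    (fun S z hz hzS hle => huniq _ _ z
      ⟨hz, Set.mem_iInter.2 fun i => hzS _ (S.orderEmbOfFin_mem rfl i)⟩ hle)
  have hxe : ∀ I, xN N (fun i => ω (e I (.inl i))) = x I.1 := by
    have : ∀ (n : ℕ) (S : Finset (Fin (N + m))) (h : S.card = n),
        xN n (fun i => ω (S.orderEmbOfFin h i)) = x S := by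
      rintro n S rfl
      rfl
    intro I
    simp only [he]
    exact this N I.1 I.2
  have hV := V.card_le_hyperTail hd hdN (k := k) (by simp) (by simpa using hVcard)
  rw [Fintype.card_fin] at hV
  refine le_trans ?_ hV
  refine Finset.card_le_card_of_injOn Subtype.val (fun I hI => ?_) Subtype.val_injective.injOn
  simp only [Finset.coe_filter, Finset.mem_univ, true_and, Set.mem_ofPred_eq,
    Finset.mem_powersetCard, Finset.subset_univ] at hI ⊢
  refine ⟨I.2, hI.trans ?_⟩
  refine Finset.card_le_card_of_injOn (fun j => e I (.inr j)) (fun j hj => ?_)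
    ((e I).injective.comp Sum.inr_injective).injOn
  simp only [Finset.coe_filter, Finset.mem_univ, true_and, Set.mem_ofPred_eq, hxe] at hj
  exact hVviol I.1 _ hj

theorem measurableSet_notMem_of_unique_minimizer [MeasurableSpace Δ]
    (hfeas : ∀ (N : ℕ) (ωs : Fin N → Δ), xN N ωs ∈ X ∩ ⋂ i, Xδ (ωs i))
    (huniq : ∀ (N : ℕ) (ωs : Fin N → Δ), ∀ y ∈ X ∩ ⋂ i, Xδ (ωs i),
      ⟪c, y⟫ ≤ ⟪c, xN N ωs⟫ → y = xN N ωs)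
    (hopt : ∀ (N : ℕ) (ωs : Fin N → Δ), ∀ y ∈ X ∩ ⋂ i, Xδ (ωs i), ⟪c, xN N ωs⟫ ≤ ⟪c, y⟫)
    (hmeas : ∀ N, Measurable (xN N)) (N : ℕ) :
    MeasurableSet {p : (Fin N → Δ) × Δ | xN N p.1 ∉ Xδ p.2} := by
  have hsnoc : Measurable fun p : (Fin N → Δ) × Δ => (Fin.snoc p.1 p.2 : Fin (N + 1) → Δ) := by
    refine measurable_pi_lambda _ fun i => ?_
    induction i using Fin.lastCases with
    | last => simpa using measurable_snd
    | cast i =>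
      simp only [Fin.snoc_castSucc]
      exact (measurable_pi_apply i).comp measurable_fst
  have hset : {p : (Fin N → Δ) × Δ | xN N p.1 ∉ Xδ p.2} =
      {p | xN (N + 1) (Fin.snoc p.1 p.2) = xN N p.1}ᶜ := by
    ext ⟨ω, δ⟩
    simp only [Set.mem_ofPred_eq, Set.mem_compl_iff, not_iff_not]
    have hf := hfeas (N + 1) (Fin.snoc ω δ)
    constructor
    · intro h
      refine (huniq _ _ _ ⟨(hfeas N ω).1, Set.mem_iInter.2 fun i => ?_⟩ ?_).symm
      · induction i using Fin.lastCases with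
        | last => simpa using h
        | cast i => simpa using Set.mem_iInter.1 (hfeas N ω).2 i
      · refine hopt N ω _ ⟨hf.1, Set.mem_iInter.2 fun i => ?_⟩
        simpa using Set.mem_iInter.1 hf.2 i.castSucc
    · intro h
      rw [← h]
      simpa using Set.mem_iInter.1 hf.2 (Fin.last N)
  rw [hset]
  exact (measurableSet_eq_fun ((hmeas _).comp hsnoc) ((hmeas N).comp measurable_fst)).compl

end Sampling

/-- Scenario optimization theorem (Theorem 1 of the paper, adapted from Campi–Garatti):
if for every `N`-tuple of sampled constraints the scenario program
`min ⟪c, x⟫` over `x ∈ X ∩ ⋂ i, X_{δᵢ}` is solvable with unique minimizer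
`x*_N(δ₁, …, δ_N)`, then the probability (under the `N`-fold product measure) that the
violation probability `V(x*_N) = P {δ | x*_N ∉ X_δ}` exceeds `ε` is at most
`∑_{i=0}^{d-1} C(N, i) ε^i (1 - ε)^{N-i}`. -/
theorem scenario_optimization
    {Δ : Type*} [MeasurableSpace Δ] (P : Measure Δ) [IsProbabilityMeasure P]
    (d : ℕ) (hd : 1 ≤ d)
    (c : EuclideanSpace ℝ (Fin d))
    (X : Set (EuclideanSpace ℝ (Fin d))) (hX : Convex ℝ X)
    (Xδ : Δ → Set (EuclideanSpace ℝ (Fin d)))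
    (hXδ : ∀ δ : Δ, Convex ℝ (Xδ δ))
    (hmeas : ∀ x : EuclideanSpace ℝ (Fin d), MeasurableSet {δ : Δ | x ∉ Xδ δ})
    (xN : ∀ N : ℕ, (Fin N → Δ) → EuclideanSpace ℝ (Fin d))
    (hfeas : ∀ (N : ℕ) (ωs : Fin N → Δ), xN N ωs ∈ X ∩ (⋂ i, Xδ (ωs i)))
    (hopt : ∀ (N : ℕ) (ωs : Fin N → Δ), ∀ y ∈ X ∩ (⋂ i, Xδ (ωs i)),
      ⟪c, xN N ωs⟫ ≤ ⟪c, y⟫)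
    (huniq : ∀ (N : ℕ) (ωs : Fin N → Δ), ∀ y ∈ X ∩ (⋂ i, Xδ (ωs i)),
      ⟪c, y⟫ = ⟪c, xN N ωs⟫ → y = xN N ωs)
    (hxNmeas : ∀ N : ℕ, Measurable (xN N))
    (hVmeas : ∀ N : ℕ, Measurable fun ωs : Fin N → Δ => P {δ : Δ | xN N ωs ∉ Xδ δ})
    (N : ℕ) (ε : ℝ) (hε : ε ∈ Set.Icc (0 : ℝ) 1) :
    (Measure.pi fun _ : Fin N => P)
      {ωs : Fin N → Δ | P {δ : Δ | xN N ωs ∉ Xδ δ} > ENNReal.ofReal ε}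
      ≤ ENNReal.ofReal
          (∑ i ∈ Finset.range d, (N.choose i : ℝ) * ε ^ i * (1 - ε) ^ (N - i)) := by
  rcases lt_or_ge N d with hNd | hdN
  · have hsub : 0 ≤ 1 - ε := sub_nonneg.2 hε.2
    refine prob_le_one.trans ?_
    rw [← ENNReal.ofReal_one]
    refine ENNReal.ofReal_le_ofReal ?_
    calc (1 : ℝ) = (ε + (1 - ε)) ^ N := by simp
      _ = ∑ i ∈ Finset.range (N + 1), (N.choose i : ℝ) * ε ^ i * (1 - ε) ^ (N - i) := by
          rw [add_pow]
          exact Finset.sum_congr rfl fun i _ => by ring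
      _ ≤ _ := by
          refine Finset.sum_le_sum_of_subset_of_nonneg (by simpa using hNd) fun i _ _ => ?_
          have := hε.1
          positivity
  · have huniq' : ∀ (N : ℕ) (ωs : Fin N → Δ), ∀ y ∈ X ∩ ⋂ i, Xδ (ωs i),
        ⟪c, y⟫ ≤ ⟪c, xN N ωs⟫ → y = xN N ωs :=
      fun N ωs y hy hle => huniq N ωs y hy (hle.antisymm (hopt N ωs y hy))
    have hW := measurableSet_notMem_of_unique_minimizer hfeas huniq' hopt hxNmeas N
    refine measure_lt_measure_section_le P hdN hε.1 hε.2 hW fun m k _ => ?_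
    have hcompl : ∀ I : {I : Finset (Fin (N + m)) // I.card = N}, I.1ᶜ.card = m := by
      intro I
      rw [Finset.card_compl, I.2, Fintype.card_fin, Nat.add_sub_cancel_left]
    have h := card_mul_measure_prod_pi_le P (fun I => finSumEquivOfFinset I.2 (hcompl I))
      (measurableSet_le_card_filter hW k) fun ω => by
        convert card_filter_violation_le_hyperTail hd hX hXδ hfeas huniq' hdN k
          (fun I => finSumEquivOfFinset I.2 (hcompl I)) (fun I i => rfl) ω
        simp only [Set.mem_ofPred_eq]
        congr!
    rw [Fintype.card_finset_len, Fintype.card_fin] at h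
    exact h
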